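/- Let D, L ≥ 1, K ≥ D with D | K, N = DL+1, and M the D×D matrix defined from β_j = DL/C(D,j). If P_{K−D} ∈ ℝ^D satisfies 1^T (I+M)^{K−D} P_{K−D} = 1, then 1^T M^{K−D} P_{K−D} = N^{1 − K/D}. In particular, the scheme's zero-query probability Σ_{j=1}^D P_{0,j} equals (DL+1)^{1−K/D}. -/

import Mathlib

open Matrix Finset

/-- β_j = D·L / C(D,j). -/
noncomputable def betaPIR (D L j : ℕ) : ℝ := (D * L : ℝ) / (D.choose j : ℝ)

/-- The D×D matrix M: first row all 1/β₁, subdiagonal entries β_j/β_{j+1}, zeros elsewhere. -/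
noncomputable def Mpir (D L : ℕ) : Matrix (Fin D) (Fin D) ℝ :=
  Matrix.of fun i j =>
    if i.val = 0 then 1 / betaPIR D L 1
    else if i.val = j.val + 1 then betaPIR D L (j.val + 1) / betaPIR D L (j.val + 2)
    else 0

/-- The vector supported at coordinate `k`, with value `C(D, k+1) / D` there. These vectors form a
chain for `Mpir D L`, ending at `0` for `k = D`. -/
noncomputable def chainVec (D k : ℕ) : Fin D → ℝ :=
  fun i => if i.val = k then (D.choose (k + 1) : ℝ) / D else 0

theorem chainVec_eq_smul_single {D : ℕ} (j : Fin D) :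
    chainVec D j = ((D.choose (j.val + 1) : ℝ) / D) • Pi.single j (1 : ℝ) := by
  ext i
  by_cases h : i = j
  · subst h
    simp [chainVec]
  · simp [chainVec, h, Fin.val_eq_val]

theorem chainVec_self (D : ℕ) : chainVec D D = 0 := by
  ext i
  simp [chainVec, i.isLt.ne]

theorem Mpir_mulVec_chainVec {D L : ℕ} (hL : 1 ≤ L) {k : ℕ} (hk : k < D) :
    Mpir D L *ᵥ chainVec D k
      = ((D.choose (k + 1) : ℝ) / (D * L)) • chainVec D 0 + chainVec D (k + 1) := by
  have hD0 : (D : ℝ) ≠ 0 := by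
    have : D ≠ 0 := by omega
    exact_mod_cast this
  have hL0 : (L : ℝ) ≠ 0 := by
    have : L ≠ 0 := by omega
    exact_mod_cast this
  have hc : (D.choose (k + 1) : ℝ) ≠ 0 := by
    have := (Nat.choose_pos (show k + 1 ≤ D by omega)).ne'
    exact_mod_cast this
  have h := chainVec_eq_smul_single (⟨k, hk⟩ : Fin D)
  simp only at h
  rw [h, mulVec_smul, mulVec_single_one]
  ext i
  simp only [Pi.smul_apply, Pi.add_apply, smul_eq_mul, Matrix.col_apply, Mpir, Matrix.of_apply,
    chainVec, betaPIR]
  by_cases h0 : i.val = 0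
  · simp only [h0, if_true, Nat.choose_one_right, zero_add]
    rw [if_neg (by omega)]
    field_simp
    simp
  · by_cases h1 : i.val = k + 1
    · have hc' : (D.choose (k + 1 + 1) : ℝ) ≠ 0 := by
        have := (Nat.choose_pos (show k + 1 + 1 ≤ D by omega)).ne'
        exact_mod_cast this
      simp only [h1, if_true]
      simp
      field_simp
    · simp [h0, h1]

theorem chainVec_eq_mulVec {D L : ℕ} (hL : 1 ≤ L) {k : ℕ} (hk : k ≤ D) :
    chainVec D k = (Mpir D L ^ k
      - ∑ i ∈ range k, ((D.choose (i + 1) : ℝ) / (D * L)) • Mpir D L ^ (k - (i + 1)))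
        *ᵥ chainVec D 0 := by
  induction k with
  | zero => simp
  | succ k ih =>
    have h := Mpir_mulVec_chainVec hL (show k < D by omega)
    rw [← sub_eq_iff_eq_add'] at h
    rw [← h]
    nth_rewrite 1 [ih (by omega)]
    rw [mulVec_mulVec, sum_range_succ, mul_sub, ← pow_succ', mul_sum]
    have hs : ∑ i ∈ range k, Mpir D L *
          (((D.choose (i + 1) : ℝ) / (D * L)) • Mpir D L ^ (k - (i + 1)))
        = ∑ i ∈ range k, ((D.choose (i + 1) : ℝ) / (D * L)) • Mpir D L ^ (k + 1 - (i + 1)) := by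
      refine sum_congr rfl fun i hi => ?_
      rw [mem_range] at hi
      rw [mul_smul_comm, ← pow_succ', show k - (i + 1) + 1 = k + 1 - (i + 1) by omega]
    rw [hs, ← sub_sub, sub_mulVec _ (_ • _), Nat.sub_self, pow_zero, smul_mulVec, one_mulVec]

theorem one_add_Mpir_pow {D L : ℕ} (hD : 1 ≤ D) (hL : 1 ≤ L) :
    (1 + Mpir D L) ^ D = (D * L + 1 : ℝ) • Mpir D L ^ D := by
  have hDL : (D * L : ℝ) ≠ 0 := by
    have : D * L ≠ 0 := by positivity
    exact_mod_cast this
  set A := (1 + Mpir D L) ^ D - (D * L + 1 : ℝ) • Mpir D L ^ D with hA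
  have hA' : A = -(D * L : ℝ) • (Mpir D L ^ D
      - ∑ i ∈ range D, ((D.choose (i + 1) : ℝ) / (D * L)) • Mpir D L ^ (D - (i + 1))) := by
    have hs : (D * L : ℝ) • ∑ i ∈ range D,
          ((D.choose (i + 1) : ℝ) / (D * L)) • Mpir D L ^ (D - (i + 1))
        = ∑ i ∈ range D, (1 : Matrix (Fin D) (Fin D) ℝ) ^ (i + 1) * Mpir D L ^ (D - (i + 1))
            * (D.choose (i + 1) : Matrix (Fin D) (Fin D) ℝ) := by
      rw [smul_sum]
      refine sum_congr rfl fun i _ => ?_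
      rw [smul_smul, mul_div_cancel₀ _ hDL, one_pow, one_mul, ← nsmul_eq_mul',
        Nat.cast_smul_eq_nsmul]
    rw [hA, (Commute.one_left _).add_pow, sum_range_succ', ← hs, neg_smul, smul_sub, add_smul]
    simp
  have hcomm : Commute A (Mpir D L) :=
    (((Commute.one_left _).add_left (Commute.refl _)).pow_left D).sub_left
      (((Commute.refl _).pow_left D).smul_left _)
  have h0 : A *ᵥ chainVec D 0 = 0 := by
    rw [hA', smul_mulVec, ← chainVec_eq_mulVec hL le_rfl, chainVec_self, smul_zero]
  have hk : ∀ k ≤ D, A *ᵥ chainVec D k = 0 := by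
    intro k
    induction k with
    | zero => exact fun _ => h0
    | succ k ih =>
      intro hk
      have h := Mpir_mulVec_chainVec hL (show k < D by omega)
      rw [← sub_eq_iff_eq_add'] at h
      rw [← h, mulVec_sub, mulVec_smul, h0, smul_zero, mulVec_mulVec, hcomm.eq, ← mulVec_mulVec,
        ih (by omega), mulVec_zero, sub_zero]
  have hzero : A = 0 := by
    ext i j
    have h := hk j j.isLt.le
    have hc : ((D.choose (j.val + 1) : ℝ) / D) ≠ 0 := by
      have := Nat.choose_pos (show j.val + 1 ≤ D from j.isLt)
      positivity
    rw [chainVec_eq_smul_single, mulVec_smul, smul_eq_zero_iff_right hc, mulVec_single_one] at h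
    exact congrFun h i
  exact sub_eq_zero.mp hzero

theorem zero_query_probability (D L K : ℕ) (hD : 1 ≤ D) (hL : 1 ≤ L)
    (hDK : D ∣ K) (hK : D ≤ K) (P : Fin D → ℝ)
    (hP : ∑ j, (∑ i, ((1 + Mpir D L) ^ (K - D)) i j) * P j = 1) :
    ∑ j, (∑ i, ((Mpir D L) ^ (K - D)) i j) * P j
      = (D * L + 1 : ℝ) ^ ((1 : ℤ) - (K / D : ℤ)) := by
  obtain ⟨m, rfl⟩ := hDK
  obtain ⟨n, rfl⟩ : ∃ n, m = n + 1 := ⟨m - 1, by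
    have : m ≠ 0 := by
      rintro rfl
      omega
    omega⟩
  have hsub : D * (n + 1) - D = D * n := by rw [mul_add, mul_one, Nat.add_sub_cancel]
  have hDz : (D : ℤ) ≠ 0 := by omega
  have hexp : (1 : ℤ) - ((D * (n + 1) : ℕ) : ℤ) / (D : ℤ) = -(n : ℤ) := by
    push_cast
    rw [Int.mul_ediv_cancel_left _ hDz]
    ring
  rw [hsub, pow_mul, one_add_Mpir_pow hD hL, smul_pow, ← pow_mul] at hP
  simp only [Matrix.smul_apply, smul_eq_mul, ← mul_sum, mul_assoc] at hP
  rw [hsub, hexp, _root_.zpow_neg, zpow_natCast]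
  exact eq_inv_of_mul_eq_one_right hP
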